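/- arXiv:2504.15839 — 3 statements merged into one kernel-verified Lean document; each statement's English description precedes it below -/
import Mathlib

section
/- There exists an absolute constant C > 0 such that for every finite non-empty set 𝒜 ⊂ ℝ with |𝒜 + 𝒜| = K·|𝒜| for some real K ≥ 1, one has sup_{n ∈ ℤ} r_𝒜(n) ≤ r_𝒜(0) ≤ C·K²·|𝒜|²·log(2|𝒜|). -/
open Pointwise

/-- `rFinset A n` is the number of quadruples `(a₁,a₂,a₃,a₄) ∈ A⁴` with
`a₁a₂ - a₃a₄ = n`. -/
noncomputable def rFinset (A : Finset ℝ) (n : ℝ) : ℕ :=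
  Nat.card {a : ℝ × ℝ × ℝ × ℝ //
    a.1 ∈ A ∧ a.2.1 ∈ A ∧ a.2.2.1 ∈ A ∧ a.2.2.2 ∈ A ∧
    a.1 * a.2.1 - a.2.2.1 * a.2.2.2 = n}

/-- The quadruples counted by `rFinset A n`. -/
noncomputable def quadruples (A : Finset ℝ) (n : ℝ) : Finset (ℝ × ℝ × ℝ × ℝ) :=
  (A ×ˢ A ×ˢ A ×ˢ A).filter fun a => a.1 * a.2.1 - a.2.2.1 * a.2.2.2 = n

lemma rFinset_eq_card (A : Finset ℝ) (n : ℝ) : rFinset A n = (quadruples A n).card := by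
  rw [rFinset, ← Nat.card_eq_finsetCard]
  refine Nat.card_congr (Equiv.subtypeEquivRight fun a => ?_)
  simp [quadruples, and_assoc]

/-- The pairs in `A × A` with product `x`. -/
noncomputable def mulPairs (A : Finset ℝ) (x : ℝ) : Finset (ℝ × ℝ) :=
  (A ×ˢ A).filter fun p => p.1 * p.2 = x

lemma mulPairs_eq_empty {A : Finset ℝ} {x : ℝ} (hx : x ∉ A * A) : mulPairs A x = ∅ := by
  refine Finset.filter_eq_empty_iff.2 fun p hp h => hx ?_
  rw [Finset.mem_product] at hp
  exact h ▸ Finset.mul_mem_mul hp.1 hp.2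

lemma card_quadruples (A : Finset ℝ) (n : ℝ) :
    (quadruples A n).card =
      ∑ x ∈ A * A, (mulPairs A x).card * (mulPairs A (x - n)).card := by
  have hmaps : Set.MapsTo (fun a : ℝ × ℝ × ℝ × ℝ => a.1 * a.2.1) (quadruples A n)
      (A * A : Finset ℝ) := by
    intro a ha
    rw [Finset.mem_coe] at ha ⊢
    simp only [quadruples, Finset.mem_filter, Finset.mem_product] at ha
    exact Finset.mul_mem_mul ha.1.1 ha.1.2.1
  rw [Finset.card_eq_sum_card_fiberwise hmaps]
  refine Finset.sum_congr rfl fun x _ => ?_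
  rw [← Finset.card_product]
  refine Finset.card_nbij' (fun a => ((a.1, a.2.1), (a.2.2.1, a.2.2.2)))
    (fun b => (b.1.1, b.1.2, b.2.1, b.2.2)) ?_ ?_ (fun _ _ => rfl) (fun _ _ => rfl)
  · rintro ⟨a, b, c, d⟩ h
    simp only [quadruples, mulPairs, Finset.coe_filter, Finset.coe_product, Set.mem_prod,
      Finset.mem_filter, Finset.mem_product, Set.mem_ofPred_eq] at h ⊢
    obtain ⟨⟨⟨ha, hb, hc, hd⟩, h1⟩, h2⟩ := h
    exact ⟨⟨⟨ha, hb⟩, h2⟩, ⟨hc, hd⟩, by linarith⟩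
  · rintro ⟨⟨a, b⟩, c, d⟩ h
    simp only [quadruples, mulPairs, Finset.coe_filter, Finset.coe_product, Set.mem_prod,
      Finset.mem_filter, Finset.mem_product, Set.mem_ofPred_eq] at h ⊢
    obtain ⟨⟨⟨ha, hb⟩, h2⟩, ⟨hc, hd⟩, h1⟩ := h
    exact ⟨⟨⟨ha, hb, hc, hd⟩, by linarith⟩, h2⟩

lemma card_quadruples_le (A : Finset ℝ) (n : ℝ) :
    (quadruples A n).card ≤ (quadruples A 0).card := by
  rw [card_quadruples, card_quadruples]
  simp only [sub_zero]
  set m : ℝ → ℕ := fun x => (mulPairs A x).card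
  have hshift : ∑ x ∈ A * A, m (x - n) * m (x - n) ≤ ∑ x ∈ A * A, m x * m x := by
    rw [← Finset.sum_image (s := A * A) (g := fun x => x - n) (f := fun y => m y * m y)
      (fun x _ y _ h => sub_left_injective h)]
    refine Finset.sum_le_sum_of_ne_zero fun x _ hx => ?_
    by_contra h
    exact hx (by simp [m, mulPairs_eq_empty h])
  have hcs : ∑ x ∈ A * A, 2 * (m x * m (x - n)) ≤
      ∑ x ∈ A * A, (m x * m x + m (x - n) * m (x - n)) := by
    refine Finset.sum_le_sum fun x _ => ?_
    have := two_mul_le_add_sq (m x) (m (x - n))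
    nlinarith
  rw [← Finset.mul_sum, Finset.sum_add_distrib] at hcs
  change ∑ x ∈ A * A, m x * m (x - n) ≤ ∑ x ∈ A * A, m x * m x
  omega

/-- The points of `A × A` in the open right half-plane on the line of slope `l` through `0`. -/
noncomputable def rayPoints (A : Finset ℝ) (l : ℝ) : Finset (ℝ × ℝ) :=
  (A ×ˢ A).filter fun p => 0 < p.1 ∧ p.2 = l * p.1

lemma mem_rayPoints {A : Finset ℝ} {l : ℝ} {p : ℝ × ℝ} :
    p ∈ rayPoints A l ↔ (p.1 ∈ A ∧ p.2 ∈ A) ∧ 0 < p.1 ∧ p.2 = l * p.1 := by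
  simp [rayPoints]

lemma card_rayPoints_le (A : Finset ℝ) (l : ℝ) : (rayPoints A l).card ≤ A.card := by
  refine Finset.card_le_card_of_injOn Prod.fst (fun p hp => (mem_rayPoints.1 hp).1.1) ?_
  intro p hp q hq h
  have hp := (mem_rayPoints.1 hp).2.2
  have hq := (mem_rayPoints.1 hq).2.2
  ext
  · exact h
  · rw [hp, hq, h]

/-- The points of `(A + A) × (A + A)` in the right half-plane below the line of slope `M`. -/
noncomputable def sumsBelow (A : Finset ℝ) (M : ℝ) : Finset (ℝ × ℝ) :=
  ((A + A) ×ˢ (A + A)).filter fun p => 0 < p.1 ∧ p.2 < M * p.1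

lemma mem_sumsBelow {A : Finset ℝ} {M : ℝ} {p : ℝ × ℝ} :
    p ∈ sumsBelow A M ↔ (p.1 ∈ A + A ∧ p.2 ∈ A + A) ∧ 0 < p.1 ∧ p.2 < M * p.1 := by
  rw [sumsBelow, Finset.mem_filter, Finset.mem_product]

lemma card_sumsBelow_add_le (A : Finset ℝ) {m M : ℝ} (h : m < M) :
    (sumsBelow A m).card + (rayPoints A m).card * (rayPoints A M).card ≤
      (sumsBelow A M).card := by
  classical
  have hinj : Set.InjOn (fun q : (ℝ × ℝ) × (ℝ × ℝ) => q.1 + q.2)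
      (rayPoints A m ×ˢ rayPoints A M : Finset _) := by
    rintro ⟨⟨a, b⟩, c, d⟩ h1 ⟨⟨a', b'⟩, c', d'⟩ h2 he
    simp only [Finset.coe_product, Set.mem_prod, Finset.mem_coe, mem_rayPoints] at h1 h2
    obtain ⟨⟨-, -, rfl⟩, -, -, rfl⟩ := h1
    obtain ⟨⟨-, -, rfl⟩, -, -, rfl⟩ := h2
    simp only [Prod.mk_add_mk, Prod.mk.injEq] at he
    obtain ⟨e1, e2⟩ := he
    have hc : c = c' := by
      have : (M - m) * (c - c') = 0 := by linear_combination e2 - m * e1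
      rcases mul_eq_zero.1 this with h' | h' <;> linarith
    have ha : a = a' := by linarith
    rw [ha, hc]
  rw [← Finset.card_product, ← Finset.card_image_of_injOn hinj, ← Finset.card_union_of_disjoint]
  · refine Finset.card_le_card (Finset.union_subset ?_ ?_)
    · intro p hp
      rw [mem_sumsBelow] at hp ⊢
      exact ⟨hp.1, hp.2.1, hp.2.2.trans (mul_lt_mul_of_pos_right h hp.2.1)⟩
    · intro p hp
      obtain ⟨⟨q, r⟩, hqr, rfl⟩ := Finset.mem_image.1 hp
      rw [Finset.mem_product, mem_rayPoints, mem_rayPoints] at hqr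
      obtain ⟨⟨⟨h1, h2⟩, h3, h4⟩, ⟨h5, h6⟩, h7, h8⟩ := hqr
      rw [mem_sumsBelow]
      refine ⟨⟨Finset.add_mem_add h1 h5, Finset.add_mem_add h2 h6⟩, add_pos h3 h7, ?_⟩
      simp only [Prod.snd_add, Prod.fst_add] at *
      nlinarith [mul_lt_mul_of_pos_right h h3]
  · rw [Finset.disjoint_left]
    intro p hp hp'
    obtain ⟨⟨q, r⟩, hqr, rfl⟩ := Finset.mem_image.1 hp'
    rw [Finset.mem_product, mem_rayPoints, mem_rayPoints] at hqr
    obtain ⟨⟨-, h3, h4⟩, -, h7, h8⟩ := hqr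
    have hlt := (mem_sumsBelow.1 hp).2.2
    simp only [Prod.snd_add, Prod.fst_add] at *
    nlinarith [mul_lt_mul_of_pos_right h h7]

lemma card_mul_sq_le_card_sumsBelow (A : Finset ℝ) (t : ℕ) (L : Finset ℝ) :
    (∀ l ∈ L, t ≤ (rayPoints A l).card) → ∀ M, (∀ l ∈ L, l < M) →
      t ≤ (rayPoints A M).card → L.card * t ^ 2 ≤ (sumsBelow A M).card := by
  induction L using Finset.induction_on_max with
  | empty => simp
  | insert m L hm ih =>
    intro hL M hM ht
    have htm := hL m (Finset.mem_insert_self m L)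
    have h1 := ih (fun l hl => hL l (Finset.mem_insert_of_mem hl)) m hm htm
    have h2 := card_sumsBelow_add_le A (hM m (Finset.mem_insert_self m L))
    have h3 := Nat.mul_le_mul htm ht
    rw [Finset.card_insert_of_notMem fun h => lt_irrefl m (hm m h)]
    nlinarith

/-- Solymosi's bound on the number of lines through the origin rich in points of `A × A`. -/
lemma card_mul_sq_le_of_rich {A : Finset ℝ} {t : ℕ} {L : Finset ℝ}
    (hL : ∀ l ∈ L, t ≤ (rayPoints A l).card) :
    L.card * t ^ 2 ≤ 2 * (A + A).card ^ 2 := by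
  classical
  rcases L.eq_empty_or_nonempty with rfl | hne
  · simp
  have hmax := L.max'_mem hne
  have h1 := card_mul_sq_le_card_sumsBelow A t (L.erase (L.max' hne))
    (fun l hl => hL l (Finset.mem_of_mem_erase hl)) (L.max' hne)
    (fun l hl => L.lt_max'_of_mem_erase_max' hne hl) (hL _ hmax)
  have h2 : (sumsBelow A (L.max' hne)).card ≤ (A + A).card ^ 2 := by
    rw [sq, ← Finset.card_product]
    exact Finset.card_filter_le _ _
  have h3 : t ≤ A.card := (hL _ hmax).trans (card_rayPoints_le A _)
  have h4 : t ≤ (A + A).card := by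
    rcases A.eq_empty_or_nonempty with rfl | hA
    · simpa using h3
    · exact h3.trans (Finset.card_le_card_add_right hA)
  have h5 := Nat.pow_le_pow_left h4 2
  have h6 := Finset.card_erase_add_one hmax
  rw [← h6]
  linarith

lemma sq_eq_sum_ite {r N : ℕ} (h : r ≤ N) :
    (r : ℝ) ^ 2 = ∑ i ∈ Finset.range N, if i + 1 ≤ r then (2 * (i : ℝ) + 1) else 0 := by
  have hf : (Finset.range N).filter (fun i => i + 1 ≤ r) = Finset.range r := by
    ext i
    simp only [Finset.mem_filter, Finset.mem_range]
    omega
  rw [← Finset.sum_filter, hf]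
  clear hf h
  induction r with
  | zero => simp
  | succ k ih =>
    rw [Finset.sum_range_succ, ← ih]
    push_cast
    ring

lemma sum_sq_card_rayPoints_le (A L : Finset ℝ) :
    ∑ l ∈ L, ((rayPoints A l).card : ℝ) ^ 2 ≤
      4 * ((A + A).card : ℝ) ^ 2 * (1 + Real.log A.card) := by
  classical
  have hterm : ∀ i ∈ Finset.range A.card,
      (∑ l ∈ L, if i + 1 ≤ (rayPoints A l).card then (2 * (i : ℝ) + 1) else 0) ≤
        4 * ((A + A).card : ℝ) ^ 2 * ((i : ℝ) + 1)⁻¹ := by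
    intro i _
    rw [← Finset.sum_filter, Finset.sum_const, nsmul_eq_mul]
    have h := card_mul_sq_le_of_rich (A := A) (t := i + 1)
      (L := L.filter fun l => i + 1 ≤ (rayPoints A l).card) (fun l hl => (Finset.mem_filter.1 hl).2)
    set c := (L.filter fun l => i + 1 ≤ (rayPoints A l).card).card
    have h' : (c : ℝ) * ((i : ℝ) + 1) ^ 2 ≤ 2 * ((A + A).card : ℝ) ^ 2 := by exact_mod_cast h
    have hi : (0 : ℝ) < (i : ℝ) + 1 := by positivity
    rw [← div_eq_mul_inv, le_div_iff₀ hi]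
    have hc : (0 : ℝ) ≤ c := by positivity
    nlinarith [mul_nonneg hc hi.le]
  have hH := harmonic_le_one_add_log A.card
  have hsum : ((harmonic A.card : ℚ) : ℝ) = ∑ i ∈ Finset.range A.card, ((i : ℝ) + 1)⁻¹ := by
    simp [harmonic]
  calc ∑ l ∈ L, ((rayPoints A l).card : ℝ) ^ 2
      = ∑ l ∈ L, ∑ i ∈ Finset.range A.card,
          if i + 1 ≤ (rayPoints A l).card then (2 * (i : ℝ) + 1) else 0 :=
        Finset.sum_congr rfl fun l _ => sq_eq_sum_ite (card_rayPoints_le A l)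
    _ = ∑ i ∈ Finset.range A.card, ∑ l ∈ L,
          if i + 1 ≤ (rayPoints A l).card then (2 * (i : ℝ) + 1) else 0 := Finset.sum_comm
    _ ≤ ∑ i ∈ Finset.range A.card, 4 * ((A + A).card : ℝ) ^ 2 * ((i : ℝ) + 1)⁻¹ :=
        Finset.sum_le_sum hterm
    _ = 4 * ((A + A).card : ℝ) ^ 2 * ((harmonic A.card : ℚ) : ℝ) := by
        rw [hsum, Finset.mul_sum]
    _ ≤ _ := by gcongr

/-- The points of `A × A` off the vertical axis on the line of slope `l` through `0`. -/
noncomputable def linePoints (A : Finset ℝ) (l : ℝ) : Finset (ℝ × ℝ) :=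
  (A ×ˢ A).filter fun p => p.1 ≠ 0 ∧ p.2 = l * p.1

lemma card_linePoints_le (A : Finset ℝ) (l : ℝ) :
    (linePoints A l).card ≤ (rayPoints A l).card + (rayPoints (-A) l).card := by
  classical
  rw [← Finset.card_neg (rayPoints (-A) l)]
  refine (Finset.card_le_card fun p hp => ?_).trans (Finset.card_union_le _ _)
  simp only [linePoints, Finset.mem_filter, Finset.mem_product] at hp
  obtain ⟨hA, h0, hl⟩ := hp
  rw [Finset.mem_union, Finset.mem_neg', mem_rayPoints, mem_rayPoints]
  rcases h0.lt_or_gt with h | h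
  · right
    exact ⟨by simpa using hA, by simpa using h, by simp [hl]⟩
  · exact Or.inl ⟨hA, h, hl⟩

lemma card_quadruples_zero_le (A : Finset ℝ) :
    (quadruples A 0).card ≤
      3 * A.card ^ 2 + ∑ l ∈ A / A, (linePoints A l).card ^ 2 := by
  classical
  have hsub : quadruples A 0 ⊆
      (((A ×ˢ A).image fun p => ((0 : ℝ), p.1, (0 : ℝ), p.2)) ∪
        ((A ×ˢ A).image fun p => (p.1, (0 : ℝ), (0 : ℝ), p.2)) ∪
        ((A ×ˢ A).image fun p => (p.1, (0 : ℝ), p.2, (0 : ℝ)))) ∪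
      (A / A).biUnion fun l => (linePoints A l ×ˢ linePoints A l).image
        fun q => (q.1.2, q.2.1, q.1.1, q.2.2) := by
    rintro ⟨a, b, c, d⟩ h
    simp only [quadruples, Finset.mem_filter, Finset.mem_product] at h
    obtain ⟨⟨ha, hb, hc, hd⟩, h⟩ := h
    simp only [Finset.mem_union, Finset.mem_image, Finset.mem_biUnion, Finset.mem_product,
      Prod.exists, Prod.mk.injEq]
    by_cases hc0 : c = 0
    · subst hc0
      rcases mul_eq_zero.1 (show a * b = 0 by linarith) with rfl | rfl
      · exact Or.inl (Or.inl (Or.inl ⟨b, d, ⟨hb, hd⟩, rfl, rfl, rfl, rfl⟩))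
      · exact Or.inl (Or.inl (Or.inr ⟨a, d, ⟨ha, hd⟩, rfl, rfl, rfl, rfl⟩))
    by_cases hb0 : b = 0
    · subst hb0
      rcases mul_eq_zero.1 (show c * d = 0 by linarith) with rfl | rfl
      · exact absurd rfl hc0
      · exact Or.inl (Or.inr ⟨a, c, ⟨ha, hc⟩, rfl, rfl, rfl, rfl⟩)
    · refine Or.inr ⟨a / c, Finset.div_mem_div ha hc, c, a, b, d, ?_, rfl, rfl, rfl, rfl⟩
      simp only [linePoints, Finset.mem_filter, Finset.mem_product]
      refine ⟨⟨⟨hc, ha⟩, hc0, by field_simp⟩, ⟨hb, hd⟩, hb0, ?_⟩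
      field_simp
      linarith
  have hpair : ∀ f : ℝ × ℝ → ℝ × ℝ × ℝ × ℝ, ((A ×ˢ A).image f).card ≤ A.card ^ 2 := by
    intro f
    rw [sq, ← Finset.card_product]
    exact Finset.card_image_le
  refine (Finset.card_le_card hsub).trans ((Finset.card_union_le _ _).trans (add_le_add ?_ ?_))
  · refine (Finset.card_union_le _ _).trans ?_
    refine (add_le_add (Finset.card_union_le _ _) le_rfl).trans ?_
    linarith [hpair fun p => ((0 : ℝ), p.1, (0 : ℝ), p.2),
      hpair fun p => (p.1, (0 : ℝ), (0 : ℝ), p.2), hpair fun p => (p.1, (0 : ℝ), p.2, (0 : ℝ))]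
  · refine Finset.card_biUnion_le.trans (Finset.sum_le_sum fun l _ => ?_)
    rw [sq, ← Finset.card_product]
    exact Finset.card_image_le

lemma sum_sq_card_linePoints_le (A L : Finset ℝ) :
    ∑ l ∈ L, ((linePoints A l).card : ℝ) ^ 2 ≤
      16 * ((A + A).card : ℝ) ^ 2 * (1 + Real.log A.card) := by
  have hneg : (-A + -A).card = (A + A).card := by
    rw [← Finset.card_neg (A + A), neg_add]
  have h1 := sum_sq_card_rayPoints_le A L
  have h2 := sum_sq_card_rayPoints_le (-A) L
  rw [hneg, Finset.card_neg] at h2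
  have h3 : ∑ l ∈ L, ((linePoints A l).card : ℝ) ^ 2 ≤
      ∑ l ∈ L, (2 * ((rayPoints A l).card : ℝ) ^ 2 + 2 * ((rayPoints (-A) l).card : ℝ) ^ 2) := by
    refine Finset.sum_le_sum fun l _ => ?_
    have h : ((linePoints A l).card : ℝ) ≤ (rayPoints A l).card + (rayPoints (-A) l).card := by
      exact_mod_cast card_linePoints_le A l
    have h' := pow_le_pow_left₀ (Nat.cast_nonneg _) h 2
    nlinarith [sq_nonneg (((rayPoints A l).card : ℝ) - (rayPoints (-A) l).card)]
  rw [Finset.sum_add_distrib, ← Finset.mul_sum, ← Finset.mul_sum] at h3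
  linarith

theorem restricted_divisor_small_doubling :
    ∃ C : ℝ, 0 < C ∧ ∀ (A : Finset ℝ) (K : ℝ), A.Nonempty → 1 ≤ K →
      ((A + A).card : ℝ) = K * (A.card : ℝ) →
      (∀ n : ℤ, rFinset A n ≤ rFinset A 0) ∧
      (rFinset A 0 : ℝ) ≤ C * K ^ 2 * (A.card : ℝ) ^ 2 *
        Real.log (2 * (A.card : ℝ)) := by
  refine ⟨38, by norm_num, fun A K hA _ hK => ⟨fun n => ?_, ?_⟩⟩
  · rw [rFinset_eq_card, rFinset_eq_card]
    exact card_quadruples_le A n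
  rw [rFinset_eq_card]
  have hcard : (1 : ℝ) ≤ A.card := by exact_mod_cast hA.card_pos
  have hle : (A.card : ℝ) ≤ (A + A).card := by
    exact_mod_cast Finset.card_le_card_add_right hA
  have h1 : ((quadruples A 0).card : ℝ) ≤
      3 * (A.card : ℝ) ^ 2 + ∑ l ∈ A / A, ((linePoints A l).card : ℝ) ^ 2 := by
    exact_mod_cast card_quadruples_zero_le A
  have h2 := sum_sq_card_linePoints_le A (A / A)
  have hsq : (A.card : ℝ) ^ 2 ≤ ((A + A).card : ℝ) ^ 2 := by gcongr
  have hlog0 := Real.log_nonneg hcard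
  have hlog : Real.log (2 * (A.card : ℝ)) = Real.log 2 + Real.log A.card :=
    Real.log_mul (by norm_num) (by positivity)
  have hfinal : 3 + 16 * (1 + Real.log A.card) ≤ 38 * Real.log (2 * (A.card : ℝ)) := by
    linarith [Real.log_two_gt_d9]
  calc ((quadruples A 0).card : ℝ)
      ≤ ((A + A).card : ℝ) ^ 2 * (3 + 16 * (1 + Real.log A.card)) := by linarith
    _ ≤ ((A + A).card : ℝ) ^ 2 * (38 * Real.log (2 * (A.card : ℝ))) := by gcongr
    _ = _ := by rw [hK]; ring
end

section
/- There exists an absolute constant C > 0 such that for every finite non-empty set 𝒜 ⊂ ℝ with |𝒜 + 𝒜| = K·|𝒜| for some real K ≥ 1, one has I₃(𝒜) ≤ C·K⁴·|𝒜|⁸·(log(2|𝒜|))². -/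
open Pointwise

/-- `detQR (a₁,a₂,a₃,a₄) = a₁a₂ - a₃a₄`. -/
def detQR (a : ℝ × ℝ × ℝ × ℝ) : ℝ := a.1 * a.2.1 - a.2.2.1 * a.2.2.2

/-- `I3Finset A` is the number of 12-tuples `(a₁,…,a₁₂) ∈ A¹²` with
`a₁a₂ - a₃a₄ = a₅a₆ - a₇a₈ = a₉a₁₀ - a₁₁a₁₂`; equivalently `∑_n r_A(n)³`. -/
noncomputable def I3Finset (A : Finset ℝ) : ℕ :=
  Nat.card {x : Fin 3 → ℝ × ℝ × ℝ × ℝ //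
    (∀ i, (x i).1 ∈ A ∧ (x i).2.1 ∈ A ∧ (x i).2.2.1 ∈ A ∧ (x i).2.2.2 ∈ A) ∧
    ∀ i j, detQR (x i) = detQR (x j)}

section

open Finset

/-- The number of elements of `A` below `x`, divided by `b` and rounded down. -/
noncomputable def block (A : Finset ℝ) (b : ℕ) (x : ℝ) : ℕ := #{y ∈ A | y < x} / b

lemma block_mono (A : Finset ℝ) (b : ℕ) : Monotone (block A b) := by
  intro x y h
  refine Nat.div_le_div_right (card_le_card fun z hz => ?_)
  simp only [mem_filter] at hz ⊢
  exact ⟨hz.1, hz.2.trans_le h⟩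

lemma block_le (A : Finset ℝ) (b : ℕ) (x : ℝ) : block A b x ≤ #A / b :=
  Nat.div_le_div_right (card_filter_le _ _)

lemma card_block_eq_le (A : Finset ℝ) {b : ℕ} (hb : 0 < b) (j : ℕ) :
    #{x ∈ A | block A b x = j} ≤ b := by
  have h : #{x ∈ A | block A b x = j} ≤ #(Ico (j * b) (j * b + b)) := by
    refine card_le_card_of_injOn (fun x => #{y ∈ A | y < x}) ?_ ?_
    · intro x hx
      simp only [mem_coe, mem_filter] at hx
      rw [block] at hx
      have h1 := Nat.div_add_mod #{y ∈ A | y < x} b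
      have h2 := Nat.mod_lt #{y ∈ A | y < x} hb
      rw [hx.2, mul_comm] at h1
      simp only [coe_Ico, Set.mem_Ico]
      omega
    · have key : ∀ x ∈ A, ∀ y, x < y → #{z ∈ A | z < x} < #{z ∈ A | z < y} := by
        intro x hx y hxy
        refine card_lt_card ((ssubset_iff_of_subset fun z hz => ?_).2 ⟨x, ?_, ?_⟩)
        · simp only [mem_filter] at hz ⊢
          exact ⟨hz.1, hz.2.trans hxy⟩
        · simp [hx, hxy]
        · simp
      intro x hx y hy hxy
      simp only [mem_coe, mem_filter] at hx hy hxy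
      rcases lt_trichotomy x y with h | h | h
      · exact absurd hxy (key x hx.1 y h).ne
      · exact h
      · exact absurd hxy (key y hy.1 x h).ne'
  simpa using h

lemma card_pairs_block_le (A : Finset ℝ) {b : ℕ} (hb : 0 < b) :
    #{p ∈ A ×ˢ A | block A b p.1 = block A b p.2} ≤ #A * b := by
  rw [card_filter, sum_product, ← smul_eq_mul, ← sum_const]
  refine sum_le_sum fun x _ => ?_
  rw [← card_filter]
  simpa only [eq_comm] using card_block_eq_le A hb (block A b x)

lemma card_ne_pairs_block_le (A : Finset ℝ) {b : ℕ} (hb : 0 < b) :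
    #{p ∈ A ×ˢ A | p.1 ≠ p.2 ∧ block A b p.1 = block A b p.2} ≤ #A * (b - 1) := by
  rw [card_filter, sum_product, ← smul_eq_mul, ← sum_const]
  refine sum_le_sum fun x hx => ?_
  rw [← card_filter]
  have h : {y ∈ A | x ≠ y ∧ block A b x = block A b y}
      = ({y ∈ A | block A b y = block A b x}).erase x := by
    ext y
    simp only [mem_filter, mem_erase]
    constructor
    · rintro ⟨h1, h2, h3⟩
      exact ⟨h2.symm, h1, h3.symm⟩
    · rintro ⟨h1, h2, h3⟩
      exact ⟨h2, h1.symm, h3.symm⟩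
  rw [h, card_erase_of_mem (by simp [hx])]
  exact Nat.sub_le_sub_right (card_block_eq_le A hb _) 1

lemma card_le_add_card_ne_pairs {α : Type*} [DecidableEq α] (P : Finset α) (g : α → ℕ) (m : ℕ)
    (hg : ∀ x ∈ P, g x < m) :
    #P ≤ m + #{q ∈ P ×ˢ P | q.1 ≠ q.2 ∧ g q.1 = g q.2} := by
  have h1 : #P = ∑ k ∈ range m, #{x ∈ P | g x = k} :=
    card_eq_sum_card_fiberwise fun x hx => by simpa using hg x hx
  have h2 : #{q ∈ P ×ˢ P | q.1 ≠ q.2 ∧ g q.1 = g q.2}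
      = ∑ k ∈ range m, #{q ∈ {q ∈ P ×ˢ P | q.1 ≠ q.2 ∧ g q.1 = g q.2} | g q.1 = k} :=
    card_eq_sum_card_fiberwise fun x hx => by
      simp only [mem_coe, mem_filter, mem_product] at hx
      simpa using hg x.1 hx.1.1
  have h3 : m = ∑ k ∈ range m, 1 := by simp
  rw [h1, h2]
  nth_rewrite 2 [h3]
  rw [← sum_add_distrib]
  refine sum_le_sum fun k _ => ?_
  have h4 : #(({x ∈ P | g x = k}).offDiag)
      ≤ #{q ∈ {q ∈ P ×ˢ P | q.1 ≠ q.2 ∧ g q.1 = g q.2} | g q.1 = k} := by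
    refine card_le_card fun q hq => ?_
    simp only [mem_offDiag, mem_filter, mem_product] at hq ⊢
    obtain ⟨⟨h1, h2⟩, ⟨h3, h4⟩, h5⟩ := hq
    exact ⟨⟨⟨h1, h3⟩, h5, h2.trans h4.symm⟩, h2⟩
  rw [offDiag_card] at h4
  have h5 : ∀ a : ℕ, a ≤ 1 + (a * a - a) := by
    intro a
    rcases a with _ | a
    · simp
    · have : (a + 1) * (a + 1) - (a + 1) = (a + 1) * a := by
        rw [Nat.mul_succ, Nat.add_sub_cancel]
      rw [this]
      nlinarith
  exact (h5 _).trans (Nat.add_le_add_left h4 1)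

/-- Abscissae of the points of `A ×ˢ A` on the line `y = l * x - c`. -/
noncomputable def linePts (A : Finset ℝ) (l c : ℝ) : Finset ℝ := {x ∈ A | l * x - c ∈ A}

/-- Pairs of distinct points of `A ×ˢ A` on the line `y = l * x - c` lying in a common cell. -/
noncomputable def cellPairs (A : Finset ℝ) (b : ℕ) (l c : ℝ) : Finset (ℝ × ℝ) :=
  {q ∈ linePts A l c ×ˢ linePts A l c | q.1 ≠ q.2 ∧ block A b q.1 = block A b q.2 ∧
    block A b (l * q.1 - c) = block A b (l * q.2 - c)}

lemma card_linePts_le (A : Finset ℝ) (b : ℕ) (l c : ℝ) :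
    #(linePts A l c) ≤ 2 * (#A / b) + 1 + #(cellPairs A b l c) := by
  obtain ⟨g, hg, hcell⟩ : ∃ g : ℝ → ℕ, (∀ x, g x < 2 * (#A / b) + 1) ∧
      ∀ x y, g x = g y → block A b x = block A b y ∧
        block A b (l * x - c) = block A b (l * y - c) := by
    rcases le_total 0 l with hl | hl
    · refine ⟨fun x => block A b x + block A b (l * x - c), fun x => ?_, ?_⟩
      · have h1 := block_le A b x
        have h2 := block_le A b (l * x - c)
        lia
      · have key : ∀ x y, x ≤ y → block A b x + block A b (l * x - c)
            = block A b y + block A b (l * y - c) → block A b x = block A b y ∧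
            block A b (l * x - c) = block A b (l * y - c) := by
          intro x y hxy h
          have h1 := block_mono A b hxy
          have h2 : block A b (l * x - c) ≤ block A b (l * y - c) :=
            block_mono A b (by nlinarith)
          omega
        intro x y h
        rcases le_total x y with hxy | hxy
        · exact key x y hxy h
        · have := key y x hxy h.symm
          exact ⟨this.1.symm, this.2.symm⟩
    · refine ⟨fun x => block A b x + (#A / b - block A b (l * x - c)), fun x => ?_, ?_⟩
      · have h1 := block_le A b x
        lia
      · have key : ∀ x y, x ≤ y → block A b x + (#A / b - block A b (l * x - c))
            = block A b y + (#A / b - block A b (l * y - c)) → block A b x = block A b y ∧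
            block A b (l * x - c) = block A b (l * y - c) := by
          intro x y hxy h
          have h1 := block_mono A b hxy
          have h2 : block A b (l * y - c) ≤ block A b (l * x - c) :=
            block_mono A b (by nlinarith)
          have h3 := block_le A b (l * x - c)
          have h4 := block_le A b (l * y - c)
          lia
        intro x y h
        rcases le_total x y with hxy | hxy
        · exact key x y hxy h
        · have := key y x hxy h.symm
          exact ⟨this.1.symm, this.2.symm⟩
  refine (card_le_add_card_ne_pairs _ g _ fun x _ => hg x).trans (Nat.add_le_add_left ?_ _)
  refine card_le_card fun q hq => ?_
  simp only [cellPairs, mem_filter] at hq ⊢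
  exact ⟨hq.1, hq.2.1, hcell _ _ hq.2.2⟩

lemma sum_card_cellPairs_le (A : Finset ℝ) {b : ℕ} (hb : 0 < b) (Λ : Finset (ℝ × ℝ))
    (hpos : ∀ p ∈ Λ, 0 < p.2) (hinj : Set.InjOn (fun p : ℝ × ℝ => p.1 / p.2) Λ) (S : Finset ℝ) :
    ∑ z ∈ Λ ×ˢ S, #(cellPairs A b (z.1.1 / z.1.2) (z.2 / z.1.2))
      ≤ #A * (b - 1) * (#A * b) := by
  rw [← card_sigma]
  refine le_trans ?_ (Nat.mul_le_mul (card_ne_pairs_block_le A hb) (card_pairs_block_le A hb))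
  rw [← card_product]
  refine card_le_card_of_injOn (fun z => (z.2, (z.1.1.1 / z.1.1.2 * z.2.1 - z.1.2 / z.1.1.2,
    z.1.1.1 / z.1.1.2 * z.2.2 - z.1.2 / z.1.1.2))) ?_ ?_
  · rintro ⟨⟨p, n⟩, q⟩ h
    simp only [coe_sigma, Set.mem_sigma_iff, mem_coe, mem_product, cellPairs, linePts,
      mem_filter] at h ⊢
    tauto
  · rintro ⟨⟨p, n⟩, q⟩ h ⟨⟨p', n'⟩, q'⟩ h' heq
    simp only [coe_sigma, Set.mem_sigma_iff, mem_coe, mem_product, cellPairs, linePts,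
      mem_filter] at h h'
    simp only [Prod.mk.injEq] at heq
    obtain ⟨rfl, h1, h2⟩ := heq
    have hne : q.1 - q.2 ≠ 0 := sub_ne_zero.2 h.2.2.1
    have hl : p.1 / p.2 = p'.1 / p'.2 := by
      apply mul_right_cancel₀ hne
      linarith
    have hp : p = p' := hinj h.1.1 h'.1.1 hl
    subst hp
    have hn : n / p.2 = n' / p.2 := by linarith
    have hn' : n = n' := by
      have := (hpos p h.1.1).ne'
      field_simp at hn
      exact hn
    rw [hn']

lemma sum_card_linePts_le (A : Finset ℝ) (Λ : Finset (ℝ × ℝ))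
    (hpos : ∀ p ∈ Λ, 0 < p.2) (hinj : Set.InjOn (fun p : ℝ × ℝ => p.1 / p.2) Λ) (S : Finset ℝ)
    {y : ℝ} (hy : 0 < y) :
    (∑ z ∈ Λ ×ˢ S, #(linePts A (z.1.1 / z.1.2) (z.2 / z.1.2)) : ℝ)
      ≤ #Λ * #S * (2 * (#A / y) + 1) + 2 * #A ^ 2 * y ^ 2 := by
  set b : ℕ := ⌊y⌋₊ + 1 with hb
  have hyb : y < b := by
    rw [hb]; push_cast; exact Nat.lt_floor_add_one y
  have hfl : (⌊y⌋₊ : ℝ) ≤ y := Nat.floor_le hy.le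
  have h1 : ∑ z ∈ Λ ×ˢ S, #(linePts A (z.1.1 / z.1.2) (z.2 / z.1.2))
      ≤ #Λ * #S * (2 * (#A / b) + 1) + #A * (b - 1) * (#A * b) := by
    refine (sum_le_sum fun z _ => card_linePts_le A b _ _).trans ?_
    rw [sum_add_distrib, sum_const, card_product, smul_eq_mul]
    exact Nat.add_le_add_left (sum_card_cellPairs_le A (by omega) Λ hpos hinj S) _
  have h2 : ((#A / b : ℕ) : ℝ) ≤ #A / y :=
    Nat.cast_div_le.trans (div_le_div_of_nonneg_left (by positivity) hy hyb.le)
  have h3 : (((b - 1) * b : ℕ) : ℝ) ≤ 2 * y ^ 2 := by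
    rw [hb, Nat.add_sub_cancel]
    push_cast
    rcases Nat.eq_zero_or_pos ⌊y⌋₊ with h0 | h0
    · rw [h0]; simp; positivity
    · have : (1 : ℝ) ≤ ⌊y⌋₊ := by exact_mod_cast h0
      nlinarith
  calc (∑ z ∈ Λ ×ˢ S, #(linePts A (z.1.1 / z.1.2) (z.2 / z.1.2)) : ℝ)
      ≤ ((#Λ * #S * (2 * (#A / b) + 1) + #A * (b - 1) * (#A * b) : ℕ) : ℝ) := by
        exact_mod_cast h1
    _ = #Λ * #S * (2 * ((#A / b : ℕ) : ℝ) + 1) + #A ^ 2 * (((b - 1) * b : ℕ) : ℝ) := by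
        push_cast; ring
    _ ≤ #Λ * #S * (2 * (#A / y) + 1) + #A ^ 2 * (2 * y ^ 2) := by gcongr
    _ = _ := by ring

/-- The positive `c ∈ A` with `l * c ∈ A`. -/
noncomputable def slopeFiber (A : Finset ℝ) (l : ℝ) : Finset ℝ := {c ∈ A | 0 < c ∧ l * c ∈ A}

lemma sq_le_card_sums_between (A : Finset ℝ) {k : ℕ} {l m : ℝ} (hlm : l < m)
    (hl : k ≤ #(slopeFiber A l)) (hm : k ≤ #(slopeFiber A m)) :
    k ^ 2 ≤ #{p ∈ (A + A) ×ˢ (A + A) | l * p.2 < p.1 ∧ p.1 < m * p.2} := by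
  calc k ^ 2 ≤ #(slopeFiber A l) * #(slopeFiber A m) := by
        rw [sq]; exact Nat.mul_le_mul hl hm
    _ = #(slopeFiber A l ×ˢ slopeFiber A m) := (card_product _ _).symm
    _ ≤ _ := by
      refine card_le_card_of_injOn (fun q => (l * q.1 + m * q.2, q.1 + q.2)) ?_ ?_
      · rintro ⟨c, d⟩ h
        simp only [slopeFiber, mem_coe, mem_product, mem_filter] at h ⊢
        obtain ⟨⟨h1, h2, h3⟩, h4, h5, h6⟩ := h
        exact ⟨⟨add_mem_add h3 h6, add_mem_add h1 h4⟩, by nlinarith, by nlinarith⟩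
      · rintro ⟨c, d⟩ - ⟨c', d'⟩ - h
        simp only [Prod.mk.injEq] at h
        have hc : c = c' := by
          apply mul_left_cancel₀ (sub_ne_zero.2 hlm.ne)
          linear_combination h.1 - m * h.2
        rw [hc] at h
        rw [hc, add_left_cancel h.2]

lemma card_mul_sq_le_card_sums_below (A : Finset ℝ) (k : ℕ) (T : Finset ℝ) :
    (∀ l ∈ T, k ≤ #(slopeFiber A l)) → ∀ m, (∀ l ∈ T, l < m) → k ≤ #(slopeFiber A m) →
      #T * k ^ 2 ≤ #{p ∈ (A + A) ×ˢ (A + A) | 0 < p.2 ∧ p.1 < m * p.2} := by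
  induction T using Finset.induction_on_max with
  | empty => simp
  | insert l T hT ih =>
    intro hk m hm hkm
    have h1 := ih (fun x hx => hk x (mem_insert_of_mem hx)) l hT (hk l (mem_insert_self _ _))
    have hlm : l < m := hm l (mem_insert_self _ _)
    have h2 := sq_le_card_sums_between A hlm (hk l (mem_insert_self _ _)) hkm
    rw [card_insert_of_notMem fun h => (hT l h).false, add_mul, one_mul]
    refine (Nat.add_le_add h1 h2).trans ?_
    rw [← card_union_of_disjoint]
    · refine card_le_card fun p hp => ?_
      simp only [mem_union, mem_filter] at hp ⊢
      rcases hp with ⟨h, h3, h4⟩ | ⟨h, h3, h4⟩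
      · exact ⟨h, h3, by nlinarith⟩
      · exact ⟨h, by nlinarith, h4⟩
    · refine disjoint_filter.2 fun p _ h3 h4 => ?_
      linarith [h3.2, h4.1]

/-- Solymosi's bound on the number of popular slopes. -/
lemma card_mul_sq_le (A : Finset ℝ) (k : ℕ) (T : Finset ℝ)
    (hT : ∀ l ∈ T, k ≤ #(slopeFiber A l)) : #T * k ^ 2 ≤ 2 * #(A + A) ^ 2 := by
  rcases T.eq_empty_or_nonempty with rfl | hne
  · simp
  have hm := T.max'_mem hne
  have h1 := card_mul_sq_le_card_sums_below A k (T.erase (T.max' hne))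
    (fun l hl => hT l (mem_of_mem_erase hl)) (T.max' hne)
    (fun l hl => T.lt_max'_of_mem_erase_max' hne hl) (hT _ hm)
  have h2 := h1.trans (card_filter_le _ _)
  rw [card_product, ← sq] at h2
  have h3 : k ≤ #(A + A) := by
    refine (hT _ hm).trans ((card_filter_le _ _).trans ?_)
    rcases A.eq_empty_or_nonempty with rfl | hA
    · simp
    · exact card_le_card_add_right hA
  have h4 : k ^ 2 ≤ #(A + A) ^ 2 := Nat.pow_le_pow_left h3 2
  have h5 := card_erase_add_one hm
  rw [← h5]
  linarith

/-- The position of `p.2` among the elements of the fibre of the slope `p.1 / p.2`. -/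
noncomputable def slopeRank (A : Finset ℝ) (p : ℝ × ℝ) : ℕ :=
  #{c ∈ slopeFiber A (p.1 / p.2) | c ≤ p.2}

/-- Pairs in `A ×ˢ A` with positive second coordinate. -/
noncomputable def posPairs (A : Finset ℝ) : Finset (ℝ × ℝ) := {p ∈ A ×ˢ A | 0 < p.2}

lemma snd_mem_slopeFiber {A : Finset ℝ} {p : ℝ × ℝ} (hp : p ∈ posPairs A) :
    p.2 ∈ slopeFiber A (p.1 / p.2) := by
  simp only [posPairs, slopeFiber, mem_filter, mem_product] at hp ⊢
  exact ⟨hp.1.2, hp.2, by rw [div_mul_cancel₀ _ hp.2.ne']; exact hp.1.1⟩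

lemma slopeRank_mem_Icc {A : Finset ℝ} {p : ℝ × ℝ} (hp : p ∈ posPairs A) :
    slopeRank A p ∈ Icc 1 #A := by
  refine mem_Icc.2 ⟨card_pos.2 ⟨p.2, ?_⟩, (card_filter_le _ _).trans (card_filter_le _ _)⟩
  exact mem_filter.2 ⟨snd_mem_slopeFiber hp, le_rfl⟩

lemma injOn_slope (A : Finset ℝ) (k : ℕ) :
    Set.InjOn (fun p : ℝ × ℝ => p.1 / p.2) ({p ∈ posPairs A | slopeRank A p = k} : Finset _) := by
  have key : ∀ p ∈ posPairs A, ∀ q ∈ posPairs A, p.1 / p.2 = q.1 / q.2 → p.2 < q.2 →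
      slopeRank A p < slopeRank A q := by
    intro p _ q hq h hlt
    refine card_lt_card ((ssubset_iff_of_subset fun z hz => ?_).2 ⟨q.2, ?_, ?_⟩)
    · simp only [mem_filter, h] at hz ⊢
      exact ⟨hz.1, hz.2.trans hlt.le⟩
    · exact mem_filter.2 ⟨snd_mem_slopeFiber hq, le_rfl⟩
    · simp [hlt]
  intro p hp q hq h
  simp only [mem_coe, mem_filter] at hp hq h
  have h2 : p.2 = q.2 := by
    rcases lt_trichotomy p.2 q.2 with hlt | heq | hlt
    · have := key p hp.1 q hq.1 h hlt
      omega
    · exact heq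
    · have := key q hq.1 p hp.1 h.symm hlt
      omega
  have hq2 : q.2 ≠ 0 := ((mem_filter.1 hq.1).2).ne'
  rw [h2] at h
  exact Prod.ext ((div_left_inj' hq2).1 h) h2

lemma card_slopeRank_eq_mul_sq_le (A : Finset ℝ) (k : ℕ) :
    #{p ∈ posPairs A | slopeRank A p = k} * k ^ 2 ≤ 2 * #(A + A) ^ 2 := by
  rw [← card_image_of_injOn (injOn_slope A k)]
  refine card_mul_sq_le A k _ fun l hl => ?_
  obtain ⟨p, hp, rfl⟩ := mem_image.1 hl
  rw [← (mem_filter.1 hp).2]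
  exact card_filter_le _ _

/-- The quadruples with entries in `A`. -/
def quads (A : Finset ℝ) : Finset (ℝ × ℝ × ℝ × ℝ) := A ×ˢ A ×ˢ A ×ˢ A

/-- The number of representations `n = a₁a₂ - a₃a₄` with entries in `A`. -/
noncomputable def rep (A : Finset ℝ) (n : ℝ) : ℕ := #{a ∈ quads A | detQR a = n}

/-- The number of representations `n = a₁a₂ - a₃a₄` with entries in `A` and `0 < a₃`. -/
noncomputable def repPos (A : Finset ℝ) (n : ℝ) : ℕ :=
  #{a ∈ quads A | detQR a = n ∧ 0 < a.2.2.1}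

lemma repPos_le (A : Finset ℝ) (n : ℝ) :
    repPos A n ≤ ∑ p ∈ posPairs A, #(linePts A (p.1 / p.2) (n / p.2)) := by
  have hmaps : Set.MapsTo (fun a : ℝ × ℝ × ℝ × ℝ => (a.1, a.2.2.1))
      ({a ∈ quads A | detQR a = n ∧ 0 < a.2.2.1} : Finset _) (posPairs A) := by
    rintro ⟨a, b, c, d⟩ h
    simp only [mem_coe, mem_filter, quads, mem_product, posPairs] at h ⊢
    tauto
  rw [repPos, card_eq_sum_card_fiberwise hmaps]
  refine sum_le_sum fun p hp => ?_
  have hp0 : 0 < p.2 := (mem_filter.1 hp).2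
  have hy : ∀ a : ℝ × ℝ × ℝ × ℝ, detQR a = n → (a.1, a.2.2.1) = p →
      a.2.2.2 = p.1 / p.2 * a.2.1 - n / p.2 := by
    rintro a rfl rfl
    simp only [detQR] at hp0 ⊢
    field_simp
    ring
  refine card_le_card_of_injOn (fun a => a.2.1) ?_ ?_
  · intro a h
    simp only [mem_coe, mem_filter, quads, mem_product, linePts] at h ⊢
    rw [← hy a h.1.2.1 h.2]
    tauto
  · intro a h a' h' heq
    simp only [mem_coe, mem_filter] at h h' heq
    have h1 := hy a h.1.2.1 h.2
    have h2 := hy a' h'.1.2.1 h'.2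
    have h3 := h.2.trans h'.2.symm
    simp only [Prod.mk.injEq] at h3
    refine Prod.ext h3.1 (Prod.ext heq (Prod.ext h3.2 ?_))
    rw [h1, h2, heq]

lemma rep_le (A : Finset ℝ) (n : ℝ) : rep A n ≤ repPos A n + repPos (-A) n + 2 * #A ^ 2 := by
  have hneg : #{a ∈ quads A | detQR a = n ∧ a.2.2.1 < 0} ≤ repPos (-A) n := by
    refine card_le_card_of_injOn (fun a => -a) ?_ (neg_injective.injOn)
    rintro ⟨a, b, c, d⟩ h
    simp only [mem_coe, mem_filter, quads, mem_product, Finset.mem_neg', Prod.fst_neg, Prod.snd_neg,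
      neg_neg, Left.neg_pos_iff] at h ⊢
    simpa only [detQR, Prod.fst_neg, Prod.snd_neg, neg_mul_neg] using h
  have hz1 : #{a ∈ quads A | detQR a = n ∧ a.2.2.1 = 0 ∧ a.1 ≠ 0} ≤ #(A ×ˢ A) := by
    refine card_le_card_of_injOn (fun a => (a.1, a.2.2.2)) ?_ ?_
    · rintro ⟨a, b, c, d⟩ h
      simp only [mem_coe, mem_filter, quads, mem_product] at h ⊢
      tauto
    · rintro ⟨a, b, c, d⟩ h ⟨a', b', c', d'⟩ h' heq
      simp only [mem_coe, mem_filter, Prod.mk.injEq] at h h' heq ⊢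
      simp only [detQR] at h h'
      obtain ⟨-, h1, rfl, h2⟩ := h
      obtain ⟨-, h3, rfl, h4⟩ := h'
      obtain ⟨rfl, rfl⟩ := heq
      refine ⟨rfl, mul_left_cancel₀ h2 ?_, rfl, rfl⟩
      linarith
  have hz2 : #{a ∈ quads A | detQR a = n ∧ a.2.2.1 = 0 ∧ a.1 = 0} ≤ #(A ×ˢ A) := by
    refine card_le_card_of_injOn (fun a => (a.2.1, a.2.2.2)) ?_ ?_
    · rintro ⟨a, b, c, d⟩ h
      simp only [mem_coe, mem_filter, quads, mem_product] at h ⊢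
      tauto
    · rintro ⟨a, b, c, d⟩ h ⟨a', b', c', d'⟩ h' heq
      simp only [mem_coe, mem_filter, Prod.mk.injEq] at h h' heq ⊢
      obtain ⟨-, -, rfl, rfl⟩ := h
      obtain ⟨-, -, rfl, rfl⟩ := h'
      tauto
  rw [card_product, ← sq] at hz1 hz2
  have hcover : ({a ∈ quads A | detQR a = n} : Finset _) ⊆
      {a ∈ quads A | detQR a = n ∧ 0 < a.2.2.1} ∪ {a ∈ quads A | detQR a = n ∧ a.2.2.1 < 0} ∪
      ({a ∈ quads A | detQR a = n ∧ a.2.2.1 = 0 ∧ a.1 ≠ 0} ∪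
        {a ∈ quads A | detQR a = n ∧ a.2.2.1 = 0 ∧ a.1 = 0}) := by
    intro a ha
    simp only [mem_union, mem_filter] at ha ⊢
    have := lt_trichotomy a.2.2.1 0
    tauto
  have h1 := (card_le_card hcover).trans ((card_union_le _ _).trans
    (Nat.add_le_add (card_union_le _ _) (card_union_le _ _)))
  unfold rep
  unfold repPos at hneg ⊢
  omega

lemma sum_repPos_eq_le (A S : Finset ℝ) :
    ∑ n ∈ S, repPos A n ≤ ∑ k ∈ Icc 1 #A,
      ∑ z ∈ {p ∈ posPairs A | slopeRank A p = k} ×ˢ S,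
        #(linePts A (z.1.1 / z.1.2) (z.2 / z.1.2)) := by
  refine (sum_le_sum fun n _ => repPos_le A n).trans ?_
  rw [sum_comm, ← sum_fiberwise_of_maps_to fun p hp => slopeRank_mem_Icc hp]
  simp only [sum_product, le_refl]

lemma sum_repPos_le : ∃ Z : ℝ, 0 < Z ∧ ∀ (A S : Finset ℝ) (Y : ℝ), 0 < Y → A.Nonempty →
    Y ^ 3 * #A = #(A + A) ^ 2 * #S →
    (∑ n ∈ S, repPos A n : ℝ) ≤ Z * (#A ^ 2 * Y ^ 2) + #A ^ 2 * #S := by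
  have hsum : Summable fun k : ℕ => (k : ℝ) ^ (-(4 / 3) : ℝ) :=
    Real.summable_nat_rpow.2 (by norm_num)
  have hZ0 : 0 ≤ ∑' k : ℕ, (k : ℝ) ^ (-(4 / 3) : ℝ) := tsum_nonneg fun k => by positivity
  refine ⟨6 * (∑' k : ℕ, (k : ℝ) ^ (-(4 / 3) : ℝ)) + 1, by positivity, fun A S Y hY hA hYS => ?_⟩
  have hN : (0 : ℝ) < #A := by exact_mod_cast hA.card_pos
  set M : ℕ → ℕ := fun k => #{p ∈ posPairs A | slopeRank A p = k} with hM
  have hMsum : (∑ k ∈ Icc 1 #A, M k : ℝ) ≤ #A ^ 2 := by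
    have h1 : #(posPairs A) = ∑ k ∈ Icc 1 #A, M k :=
      card_eq_sum_card_fiberwise fun p hp => slopeRank_mem_Icc hp
    have h2 : #(posPairs A) ≤ #A * #A := (card_filter_le _ _).trans (card_product _ _).le
    rw [h1, ← sq] at h2
    exact_mod_cast h2
  have hk : ∀ k ∈ Icc 1 #A,
      (∑ z ∈ {p ∈ posPairs A | slopeRank A p = k} ×ˢ S,
        #(linePts A (z.1.1 / z.1.2) (z.2 / z.1.2)) : ℝ)
      ≤ 6 * (#A ^ 2 * Y ^ 2) * (k : ℝ) ^ (-(4 / 3) : ℝ) + M k * #S := by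
    intro k hk
    have hk0 : (0 : ℝ) < k := by exact_mod_cast (mem_Icc.1 hk).1
    set u : ℝ := (k : ℝ) ^ (-(2 / 3) : ℝ) with hu
    have hu0 : 0 < u := Real.rpow_pos_of_pos hk0 _
    have hu2 : (k : ℝ) ^ (-(4 / 3) : ℝ) = u ^ 2 := by
      rw [hu, ← Real.rpow_natCast, ← Real.rpow_mul hk0.le]
      norm_num
    have hu3 : u ^ 3 * k ^ 2 = 1 := by
      rw [hu, ← Real.rpow_natCast, ← Real.rpow_mul hk0.le, ← Real.rpow_natCast,
        ← Real.rpow_add hk0]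
      norm_num
    have hpos : ∀ p ∈ ({p ∈ posPairs A | slopeRank A p = k} : Finset _), 0 < p.2 :=
      fun p hp => (mem_filter.1 (mem_filter.1 hp).1).2
    refine (sum_card_linePts_le A _ hpos (injOn_slope A k) S (mul_pos hY hu0)).trans ?_
    have hMk : (M k : ℝ) ≤ 2 * #(A + A) ^ 2 * u ^ 3 := by
      have h1 : (M k : ℝ) * k ^ 2 ≤ 2 * #(A + A) ^ 2 := by
        exact_mod_cast card_slopeRank_eq_mul_sq_le A k
      calc (M k : ℝ) = M k * k ^ 2 * u ^ 3 := by rw [mul_assoc, mul_comm _ (u ^ 3), hu3, mul_one]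
        _ ≤ _ := by gcongr
    have h2 : (M k : ℝ) * #S * (2 * (#A / (Y * u))) ≤ 4 * (#A ^ 2 * Y ^ 2) * u ^ 2 := by
      calc (M k : ℝ) * #S * (2 * (#A / (Y * u)))
          ≤ (2 * #(A + A) ^ 2 * u ^ 3) * #S * (2 * (#A / (Y * u))) := by gcongr
        _ = 4 * (#(A + A) ^ 2 * #S) * #A * u ^ 2 / Y := by field_simp; ring
        _ = 4 * (#A ^ 2 * Y ^ 2) * u ^ 2 := by rw [← hYS]; field_simp
    rw [hu2]
    change (M k : ℝ) * #S * (2 * (#A / (Y * u)) + 1) + 2 * #A ^ 2 * (Y * u) ^ 2 ≤ _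
    linarith
  calc (∑ n ∈ S, repPos A n : ℝ)
      ≤ ∑ k ∈ Icc 1 #A, ∑ z ∈ {p ∈ posPairs A | slopeRank A p = k} ×ˢ S,
        (#(linePts A (z.1.1 / z.1.2) (z.2 / z.1.2)) : ℝ) := by
        exact_mod_cast sum_repPos_eq_le A S
    _ ≤ ∑ k ∈ Icc 1 #A, (6 * (#A ^ 2 * Y ^ 2) * (k : ℝ) ^ (-(4 / 3) : ℝ) + M k * #S) :=
        sum_le_sum hk
    _ = 6 * (#A ^ 2 * Y ^ 2) * ∑ k ∈ Icc 1 #A, (k : ℝ) ^ (-(4 / 3) : ℝ)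
        + (∑ k ∈ Icc 1 #A, M k : ℝ) * #S := by
        rw [sum_add_distrib, mul_sum, sum_mul]
    _ ≤ 6 * (#A ^ 2 * Y ^ 2) * ∑' k : ℕ, (k : ℝ) ^ (-(4 / 3) : ℝ) + #A ^ 2 * #S := by
        gcongr
        exact hsum.sum_le_tsum _ fun k _ => by positivity
    _ ≤ _ := by
        have : 0 ≤ (#A : ℝ) ^ 2 * Y ^ 2 := by positivity
        linarith

lemma card_mul_cube_le : ∃ c : ℝ, 0 < c ∧ ∀ (A S : Finset ℝ) (t : ℝ), A.Nonempty →
    8 * (#A : ℝ) ^ 2 ≤ t → (∀ n ∈ S, t ≤ rep A n) →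
    t ^ 3 * #S ≤ c * (#A * #(A + A)) ^ 4 := by
  obtain ⟨Z, hZ, h⟩ := sum_repPos_le
  refine ⟨(4 * Z) ^ 3, by positivity, fun A S t hA ht hS => ?_⟩
  rcases S.eq_empty_or_nonempty with rfl | hSne
  · simp; positivity
  have hN : (0 : ℝ) < #A := by exact_mod_cast hA.card_pos
  have hD : (0 : ℝ) < #(A + A) := by exact_mod_cast (hA.add hA).card_pos
  have hS0 : (0 : ℝ) < #S := by exact_mod_cast hSne.card_pos
  obtain ⟨Y, hY, hY3⟩ : ∃ Y : ℝ, 0 < Y ∧ Y ^ 3 * #A = #(A + A) ^ 2 * #S := by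
    refine ⟨((#(A + A) : ℝ) ^ 2 * #S / #A) ^ ((3 : ℕ)⁻¹ : ℝ), by positivity, ?_⟩
    rw [Real.rpow_inv_natCast_pow (by positivity) (by norm_num)]
    field_simp
  have h1 := h A S Y hY hA hY3
  have hcard : #(-A) = #A := card_neg A
  have hcard2 : #(-A + -A) = #(A + A) := by
    rw [← neg_add, card_neg]
  have h2 := h (-A) S Y hY hA.neg (by rw [hcard, hcard2]; exact hY3)
  rw [hcard] at h2
  have h3 : t * #S ≤ 4 * Z * (#A ^ 2 * Y ^ 2) := by
    have h4 : t * #S ≤ ∑ n ∈ S, (rep A n : ℝ) := by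
      rw [mul_comm, ← nsmul_eq_mul]
      exact card_nsmul_le_sum _ _ _ hS
    have h5 : ∑ n ∈ S, (rep A n : ℝ) ≤ (∑ n ∈ S, repPos A n : ℝ)
        + (∑ n ∈ S, repPos (-A) n : ℝ) + #S * (2 * #A ^ 2) := by
      rw [← sum_add_distrib, ← nsmul_eq_mul, ← sum_const, ← sum_add_distrib]
      exact sum_le_sum fun n _ => by exact_mod_cast rep_le A n
    have h6 := mul_le_mul_of_nonneg_right ht hS0.le
    linarith
  have h0 : 0 ≤ t := le_trans (by positivity) ht
  have h7 := pow_le_pow_left₀ (by positivity) h3 3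
  have h8 : (t ^ 3 * #S) * (#S : ℝ) ^ 2 ≤ ((4 * Z) ^ 3 * (#A * #(A + A)) ^ 4) * (#S : ℝ) ^ 2 := by
    calc (t ^ 3 * #S) * (#S : ℝ) ^ 2 = (t * #S) ^ 3 := by ring
      _ ≤ _ := h7
      _ = (4 * Z) ^ 3 * #A ^ 4 * (Y ^ 3 * #A) ^ 2 := by ring
      _ = _ := by rw [hY3]; ring
  exact le_of_mul_le_mul_right h8 (by positivity)

lemma I3Finset_le (A : Finset ℝ) :
    I3Finset A ≤ ∑ n ∈ (quads A).image detQR, rep A n ^ 3 := by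
  classical
  have h : I3Finset A = #{x ∈ Fintype.piFinset fun _ : Fin 3 => quads A |
      ∀ i j, detQR (x i) = detQR (x j)} := by
    refine Nat.subtype_card _ fun x => ?_
    simp [quads]
  have hmaps : Set.MapsTo (fun x : Fin 3 → ℝ × ℝ × ℝ × ℝ => detQR (x 0))
      ({x ∈ Fintype.piFinset fun _ : Fin 3 => quads A |
        ∀ i j, detQR (x i) = detQR (x j)} : Finset _) ((quads A).image detQR) := by
    intro x hx
    simp only [mem_coe, mem_filter, Fintype.mem_piFinset] at hx
    exact mem_coe.2 (mem_image_of_mem _ (hx.1 0))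
  rw [h, card_eq_sum_card_fiberwise hmaps]
  refine sum_le_sum fun n _ => ?_
  have h2 : rep A n ^ 3 = #(Fintype.piFinset fun _ : Fin 3 => {a ∈ quads A | detQR a = n}) := by
    simp [rep]
  rw [h2]
  refine card_le_card fun x hx => ?_
  simp only [mem_filter, Fintype.mem_piFinset] at hx ⊢
  exact fun i => ⟨hx.1.1 i, (hx.1.2 i 0).trans hx.2⟩

lemma cube_le_sum_sq (r : ℕ) : r ^ 3 ≤ ∑ t ∈ Icc 1 r, 3 * t ^ 2 := by
  induction r with
  | zero => simp
  | succ r ih =>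
    rw [sum_Icc_succ_top (by omega)]
    have h : (r + 1) ^ 3 ≤ r ^ 3 + 3 * (r + 1) ^ 2 := by ring_nf; omega
    exact h.trans (Nat.add_le_add_right ih _)

lemma sum_rep_cube_le : ∃ c : ℝ, 0 < c ∧ ∀ A : Finset ℝ, A.Nonempty →
    (∑ n ∈ (quads A).image detQR, rep A n ^ 3 : ℝ)
      ≤ c * (#A * #(A + A)) ^ 4 * (1 + 4 * Real.log #A) + 192 * #A ^ 8 := by
  obtain ⟨c, hc, h⟩ := card_mul_cube_le
  refine ⟨3 * c, by positivity, fun A hA => ?_⟩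
  set V := (quads A).image detQR with hV
  have hquads : #(quads A) = #A ^ 4 := by
    simp only [quads, card_product]; ring
  have hrep : ∀ n, rep A n ≤ #A ^ 4 := fun n => hquads ▸ card_filter_le _ _
  have hlayer : ∀ n, rep A n ^ 3 ≤ ∑ t ∈ Icc 1 (#A ^ 4), if t ≤ rep A n then 3 * t ^ 2 else 0 := by
    intro n
    rw [← sum_filter]
    refine (cube_le_sum_sq _).trans (sum_le_sum_of_subset fun t ht => ?_)
    rw [mem_Icc] at ht
    exact mem_filter.2 ⟨mem_Icc.2 ⟨ht.1, ht.2.trans (hrep n)⟩, ht.2⟩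
  have hcount : ∑ t ∈ Icc 1 (#A ^ 4), #{n ∈ V | t ≤ rep A n} ≤ #A ^ 4 := by
    simp only [card_filter]
    rw [sum_comm, ← hquads, card_eq_sum_card_image detQR]
    refine sum_le_sum fun n _ => ?_
    rw [← card_filter]
    calc _ ≤ #(Icc 1 (rep A n)) := card_le_card fun t ht => by
          simp only [mem_filter, mem_Icc] at ht ⊢
          exact ⟨ht.1.1, ht.2⟩
      _ = _ := by simp [rep]
  have hlevel : ∀ t ∈ Icc 1 (#A ^ 4), (3 * t ^ 2 * #{n ∈ V | t ≤ rep A n} : ℝ)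
      ≤ 3 * c * (#A * #(A + A)) ^ 4 * (t : ℝ)⁻¹ + 192 * #A ^ 4 * #{n ∈ V | t ≤ rep A n} := by
    intro t ht
    have ht0 : (0 : ℝ) < t := by exact_mod_cast (mem_Icc.1 ht).1
    rcases le_total (8 * (#A : ℝ) ^ 2) (t : ℝ) with hle | hle
    · have h1 := h A {n ∈ V | t ≤ rep A n} t hA hle fun n hn => by
        exact_mod_cast (mem_filter.1 hn).2
      have h2 : (3 * t ^ 2 * #{n ∈ V | t ≤ rep A n} : ℝ)
          = 3 * (t ^ 3 * #{n ∈ V | t ≤ rep A n}) * (t : ℝ)⁻¹ := by field_simp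
      have h3 : 3 * (t ^ 3 * #{n ∈ V | t ≤ rep A n}) * (t : ℝ)⁻¹
          ≤ 3 * (c * (#A * #(A + A)) ^ 4) * (t : ℝ)⁻¹ := by gcongr
      have h4 : (0 : ℝ) ≤ 192 * #A ^ 4 * #{n ∈ V | t ≤ rep A n} := by positivity
      linarith
    · have h1 : (t : ℝ) ^ 2 ≤ (8 * (#A : ℝ) ^ 2) ^ 2 := by gcongr
      have h2 : (3 * t ^ 2 * #{n ∈ V | t ≤ rep A n} : ℝ)
          ≤ 3 * (8 * (#A : ℝ) ^ 2) ^ 2 * #{n ∈ V | t ≤ rep A n} := by gcongr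
      have h3 : 0 ≤ 3 * c * (#A * #(A + A)) ^ 4 * (t : ℝ)⁻¹ := by positivity
      linarith
  have hharm : ∑ t ∈ Icc 1 (#A ^ 4), (t : ℝ)⁻¹ ≤ 1 + 4 * Real.log #A := by
    have h1 := harmonic_le_one_add_log (#A ^ 4)
    rw [harmonic_eq_sum_Icc] at h1
    push_cast at h1
    rw [Real.log_pow] at h1
    exact_mod_cast h1
  calc (∑ n ∈ V, rep A n ^ 3 : ℝ)
      ≤ ∑ n ∈ V, ∑ t ∈ Icc 1 (#A ^ 4), if t ≤ rep A n then (3 * t ^ 2 : ℝ) else 0 :=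
        sum_le_sum fun n _ => by exact_mod_cast hlayer n
    _ = ∑ t ∈ Icc 1 (#A ^ 4), (3 * t ^ 2 * #{n ∈ V | t ≤ rep A n} : ℝ) := by
        rw [sum_comm]
        refine sum_congr rfl fun t _ => ?_
        rw [← sum_filter, sum_const, nsmul_eq_mul, mul_comm]
    _ ≤ ∑ t ∈ Icc 1 (#A ^ 4), (3 * c * (#A * #(A + A)) ^ 4 * (t : ℝ)⁻¹
        + 192 * #A ^ 4 * #{n ∈ V | t ≤ rep A n}) := sum_le_sum hlevel
    _ = 3 * c * (#A * #(A + A)) ^ 4 * ∑ t ∈ Icc 1 (#A ^ 4), (t : ℝ)⁻¹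
        + 192 * #A ^ 4 * (∑ t ∈ Icc 1 (#A ^ 4), #{n ∈ V | t ≤ rep A n} : ℕ) := by
        rw [sum_add_distrib, ← mul_sum, ← mul_sum]
        push_cast
        rfl
    _ ≤ 3 * c * (#A * #(A + A)) ^ 4 * (1 + 4 * Real.log #A)
        + 192 * #A ^ 4 * (#A ^ 4 : ℕ) := by gcongr
    _ = _ := by push_cast; ring

end

theorem I3_small_doubling :
    ∃ C : ℝ, 0 < C ∧ ∀ (A : Finset ℝ) (K : ℝ), A.Nonempty → 1 ≤ K →
      ((A + A).card : ℝ) = K * (A.card : ℝ) →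
      (I3Finset A : ℝ) ≤ C * K ^ 4 * (A.card : ℝ) ^ 8 *
        (Real.log (2 * (A.card : ℝ))) ^ 2 := by
  obtain ⟨c, hc, h⟩ := sum_rep_cube_le
  refine ⟨c * 12 + 192 * 4, by positivity, fun A K hA hK hAK => ?_⟩
  have hN : (1 : ℝ) ≤ A.card := by exact_mod_cast hA.card_pos
  set L := Real.log (2 * (A.card : ℝ)) with hL
  have hlogN : 0 ≤ Real.log A.card := Real.log_nonneg hN
  have hL2 : L = Real.log 2 + Real.log A.card := Real.log_mul (by norm_num) (by positivity)
  have hlog2 := Real.log_two_gt_d9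
  have hL0 : 1 / 2 ≤ L := by linarith
  have h1 : 1 + 4 * Real.log A.card ≤ 12 * L ^ 2 := by nlinarith
  have h2 : 1 ≤ 4 * L ^ 2 := by nlinarith
  have hK4 : 1 ≤ K ^ 4 := one_le_pow₀ hK
  calc (I3Finset A : ℝ) ≤ ∑ n ∈ (quads A).image detQR, (rep A n : ℝ) ^ 3 := by
        exact_mod_cast I3Finset_le A
    _ ≤ c * (A.card * (A + A).card) ^ 4 * (1 + 4 * Real.log A.card) + 192 * A.card ^ 8 := h A hA
    _ = c * K ^ 4 * A.card ^ 8 * (1 + 4 * Real.log A.card) + 192 * A.card ^ 8 * (1 * 1) := by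
        rw [hAK]; ring
    _ ≤ c * K ^ 4 * A.card ^ 8 * (12 * L ^ 2) + 192 * A.card ^ 8 * (K ^ 4 * (4 * L ^ 2)) := by
        gcongr
    _ = _ := by ring
end

section
/- For every integer N > 1, one has r_N(0) = (16/ζ(2))·N²·log N + O(N²), where ζ denotes the Riemann zeta function, with an absolute implied constant. -/
/-- `rN N h` is the number of quadruples `(a₁,a₂,a₃,a₄)` of integers with
`|aᵢ| ≤ N` and `a₁a₂ - a₃a₄ = h`. -/
noncomputable def rN (N : ℕ) (h : ℤ) : ℕ :=
  Nat.card {a : ℤ × ℤ × ℤ × ℤ //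
    |a.1| ≤ (N : ℤ) ∧ |a.2.1| ≤ (N : ℤ) ∧ |a.2.2.1| ≤ (N : ℤ) ∧ |a.2.2.2| ≤ (N : ℤ) ∧
    a.1 * a.2.1 - a.2.2.1 * a.2.2.2 = h}

/-- The Riemann zeta function at a positive integer `s`, as the real series
`∑_{n ≥ 1} n^{-s}`. -/
noncomputable def zetaNat (s : ℕ) : ℝ := ∑' n : ℕ, 1 / ((n : ℝ) + 1) ^ s

open ArithmeticFunction in
theorem totient_eq_sum_moebius {n : ℕ} (hn : 0 < n) :
    (n.totient : ℝ) = ∑ x ∈ n.divisorsAntidiagonal, (moebius x.1 : ℝ) * (x.2 : ℝ) := by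
  refine ((sum_eq_iff_sum_mul_moebius_eq (R := ℝ) (f := fun n ↦ (n.totient : ℝ))
    (g := fun n ↦ (n : ℝ))).1 (fun m _ ↦ ?_) n hn).symm
  exact_mod_cast Nat.sum_totient m

open ArithmeticFunction in
theorem sum_totient_div_sq (N : ℕ) :
    ∑ n ∈ Finset.Ioc 0 N, (n.totient : ℝ) / (n : ℝ) ^ 2 =
      ∑ d ∈ Finset.Ioc 0 N, (moebius d : ℝ) / (d : ℝ) ^ 2 * (harmonic (N / d) : ℝ) := by
  let f : ArithmeticFunction ℝ := ⟨fun n ↦ (moebius n : ℝ) / (n : ℝ) ^ 2, by simp⟩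
  let g : ArithmeticFunction ℝ := ⟨fun n ↦ (n : ℝ)⁻¹, by simp⟩
  have key := sum_Ioc_mul_eq_sum_sum f g N
  have hl : ∀ n ∈ Finset.Ioc 0 N, (f * g) n = (n.totient : ℝ) / (n : ℝ) ^ 2 := by
    intro n hn
    rw [Finset.mem_Ioc] at hn
    rw [totient_eq_sum_moebius hn.1, Finset.sum_div, mul_apply]
    refine Finset.sum_congr rfl fun x hx ↦ ?_
    obtain ⟨hx, hx0⟩ := Nat.mem_divisorsAntidiagonal.1 hx
    subst hx
    have h1 : (x.1 : ℝ) ≠ 0 := by exact_mod_cast left_ne_zero_of_mul hx0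
    have h2 : (x.2 : ℝ) ≠ 0 := by exact_mod_cast right_ne_zero_of_mul hx0
    simp only [f, g, coe_mk]
    push_cast
    field_simp
  rw [Finset.sum_congr rfl hl] at key
  rw [key]
  refine Finset.sum_congr rfl fun d _ ↦ ?_
  rw [harmonic_eq_sum_Icc]
  push_cast
  rfl

theorem hasSum_moebius_div_sq :
    HasSum (fun n : ℕ ↦ (ArithmeticFunction.moebius n : ℝ) / (n : ℝ) ^ 2) (1 / zetaNat 2) := by
  have hs : (1 : ℝ) < (2 : ℂ).re := by norm_num
  have h := (ArithmeticFunction.LSeriesSummable_moebius_iff.2 hs).LSeriesHasSum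
  have hz : riemannZeta 2 = (zetaNat 2 : ℂ) := by
    have := zeta_eq_tsum_one_div_nat_add_one_cpow hs
    rw [this, zetaNat]
    push_cast
    refine tsum_congr fun n ↦ ?_
    norm_cast
  have hm : LSeries (fun n ↦ ((ArithmeticFunction.moebius n : ℤ) : ℂ)) 2 =
      ((1 / zetaNat 2 : ℝ) : ℂ) := by
    have := ArithmeticFunction.LSeries_zeta_mul_Lseries_moebius hs
    rw [ArithmeticFunction.LSeries_zeta_eq_riemannZeta hs, hz] at this
    push_cast
    exact eq_one_div_of_mul_eq_one_right this
  rw [LSeriesHasSum, hm] at h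
  rw [← Complex.hasSum_ofReal]
  refine h.congr_fun fun n ↦ ?_
  rcases eq_or_ne n 0 with rfl | hn
  · simp
  · rw [LSeries.term_of_ne_zero hn]
    push_cast
    norm_cast

theorem one_add_log_le_two_mul_sqrt {x : ℝ} (hx : 0 < x) :
    1 + Real.log x ≤ 2 * √x := by
  have h := Real.log_le_sub_one_of_pos (Real.sqrt_pos.2 hx)
  rw [Real.log_sqrt hx.le] at h
  linarith

theorem abs_harmonic_div_sub_log_le {N d : ℕ} (hN : 0 < N) (hd : 0 < d) :
    |(harmonic (N / d) : ℝ) - Real.log N| ≤ 1 + Real.log d := by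
  have hN' : (0 : ℝ) < N := by exact_mod_cast hN
  have hd' : (0 : ℝ) < d := by exact_mod_cast hd
  have hld : 0 ≤ Real.log d := Real.log_natCast_nonneg d
  have hlN : 0 ≤ Real.log N := Real.log_natCast_nonneg N
  rcases le_or_gt d N with h | h
  · have h1 := log_le_harmonic_floor ((N : ℝ) / d) (by positivity)
    have h2 := harmonic_floor_le_one_add_log ((N : ℝ) / d)
      ((one_le_div hd').2 (by exact_mod_cast h))
    rw [Nat.floor_div_eq_div, Real.log_div hN'.ne' hd'.ne'] at h1 h2
    rw [abs_le]
    constructor <;> linarith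
  · rw [Nat.div_eq_of_lt h, harmonic_zero]
    have := Real.log_le_log hN' (by exact_mod_cast h.le : (N : ℝ) ≤ d)
    rw [abs_le]
    constructor <;> push_cast <;> linarith

theorem exists_abs_sum_totient_div_sq_sub_le :
    ∃ C : ℝ, ∀ N : ℕ, 0 < N →
      |∑ n ∈ Finset.Ioc 0 N, (n.totient : ℝ) / (n : ℝ) ^ 2 - 1 / zetaNat 2 * Real.log N| ≤ C := by
  have hsum : Summable fun d : ℕ ↦ 2 * (1 / (d : ℝ) ^ (3 / 2 : ℝ)) :=
    (Real.summable_one_div_nat_rpow.2 (by norm_num)).mul_left 2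
  refine ⟨∑' d : ℕ, 2 * (1 / (d : ℝ) ^ (3 / 2 : ℝ)), fun N hN ↦ ?_⟩
  have h1 : HasSum (fun d : ℕ ↦ (ArithmeticFunction.moebius d : ℝ) / (d : ℝ) ^ 2 *
      (harmonic (N / d) : ℝ)) (∑ n ∈ Finset.Ioc 0 N, (n.totient : ℝ) / (n : ℝ) ^ 2) := by
    rw [sum_totient_div_sq]
    refine hasSum_sum_of_ne_finset_zero fun d hd ↦ ?_
    rcases Nat.eq_zero_or_pos d with rfl | h0
    · simp
    · rw [Nat.div_eq_of_lt (by simpa [h0] using hd)]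
      simp
  have h2 := h1.sub (hasSum_moebius_div_sq.mul_right (Real.log N))
  rw [← Real.norm_eq_abs, ← h2.tsum_eq]
  refine tsum_of_norm_bounded hsum.hasSum fun d ↦ ?_
  rcases Nat.eq_zero_or_pos d with rfl | h0
  · simp
  have hd : (0 : ℝ) < d := by exact_mod_cast h0
  rw [← mul_sub, norm_mul, Real.norm_eq_abs, Real.norm_eq_abs, abs_div,
    abs_of_pos (pow_pos hd 2)]
  have hmu : |(ArithmeticFunction.moebius d : ℝ)| ≤ 1 := by
    exact_mod_cast ArithmeticFunction.abs_moebius_le_one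
  have hpow : (d : ℝ) ^ 2 = (d : ℝ) ^ (3 / 2 : ℝ) * √d := by
    rw [Real.sqrt_eq_rpow, ← Real.rpow_add hd, ← Real.rpow_natCast]
    norm_num
  calc |(ArithmeticFunction.moebius d : ℝ)| / (d : ℝ) ^ 2 *
        |(harmonic (N / d) : ℝ) - Real.log N|
      ≤ 1 / (d : ℝ) ^ 2 * (2 * √d) := by
        gcongr
        exact (abs_harmonic_div_sub_log_le hN h0).trans (one_add_log_le_two_mul_sqrt hd)
    _ = 2 * (1 / (d : ℝ) ^ (3 / 2 : ℝ)) := by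
        rw [hpow]
        have := Real.sqrt_pos.2 hd
        have := Real.rpow_pos_of_pos hd (3 / 2 : ℝ)
        field_simp

theorem card_Icc_neg_natCast (N : ℕ) : (Finset.Icc (-N : ℤ) N).card = 2 * N + 1 := by
  rw [Int.card_Icc]
  omega

theorem card_filter_mul_eq_mul {a c : ℤ} (h : ¬ (a = 0 ∧ c = 0)) (N : ℕ) :
    (((Finset.Icc (-N : ℤ) N) ×ˢ (Finset.Icc (-N : ℤ) N)).filter
      fun x ↦ a * x.1 = c * x.2).card =
      2 * (N * a.gcd c / max a.natAbs c.natAbs) + 1 := by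
  have hg : 0 < a.gcd c := Int.gcd_pos_iff.2 (by tauto)
  obtain ⟨g, a', c', hg0, hcop, ha, hc⟩ := Int.exists_gcd_one' hg
  subst ha hc
  have hcop' : IsCoprime a' c' := Int.isCoprime_iff_gcd_eq_one.2 hcop
  have hk : N * (a' * (g : ℤ)).gcd (c' * g) / max (a' * (g : ℤ)).natAbs (c' * (g : ℤ)).natAbs =
      N / max a'.natAbs c'.natAbs := by
    rw [Int.gcd_mul_right, hcop, Int.natAbs_mul, Int.natAbs_mul, Int.natAbs_natCast,
      one_mul, Nat.mul_max_mul_right, Nat.mul_div_mul_right _ _ hg0]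
  have hm : 0 < max a'.natAbs c'.natAbs := by
    by_contra! h0
    have h1 : a' = 0 := by omega
    have h2 : c' = 0 := by omega
    exact h (by simp [h1, h2])
  rw [hk]
  set k := N / max a'.natAbs c'.natAbs with hkdef
  have hmem : ∀ t : ℤ, t ∈ Finset.Icc (-k : ℤ) k ↔
      (c' * t).natAbs ≤ N ∧ (a' * t).natAbs ≤ N := by
    intro t
    have h1 : t ∈ Finset.Icc (-k : ℤ) k ↔ t.natAbs ≤ k := by rw [Finset.mem_Icc]; omega
    rw [h1, hkdef, Nat.le_div_iff_mul_le hm, mul_max, max_le_iff, Int.natAbs_mul,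
      Int.natAbs_mul, mul_comm t.natAbs, mul_comm t.natAbs, and_comm]
  have himg : (((Finset.Icc (-N : ℤ) N) ×ˢ (Finset.Icc (-N : ℤ) N)).filter
      fun x ↦ a' * (g : ℤ) * x.1 = c' * (g : ℤ) * x.2) =
      (Finset.Icc (-k : ℤ) k).image fun t ↦ (c' * t, a' * t) := by
    ext ⟨b, d⟩
    simp only [Finset.mem_filter, Finset.mem_product, Finset.mem_image, Prod.mk.injEq, hmem]
    constructor
    · rintro ⟨⟨hb, hd⟩, he⟩
      have he' : a' * b = c' * d := by
        have : (g : ℤ) ≠ 0 := by exact_mod_cast hg0.ne'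
        apply mul_right_cancel₀ this
        linarith
      obtain ⟨t, rfl⟩ : c' ∣ b := hcop'.symm.dvd_of_dvd_mul_left ⟨d, he'⟩
      rcases eq_or_ne c' 0 with rfl | hc0
      · obtain ⟨s, rfl⟩ : a' ∣ d := by
          have : IsUnit a' := isCoprime_zero_right.1 hcop'
          exact this.dvd
        refine ⟨s, ?_, by simp, rfl⟩
        rw [Finset.mem_Icc] at hb hd
        omega
      · have hd' : a' * t = d := by
          apply mul_left_cancel₀ hc0
          linarith
        subst hd'
        refine ⟨t, ?_, rfl, rfl⟩
        rw [Finset.mem_Icc] at hb hd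
        omega
    · rintro ⟨t, ht, rfl, rfl⟩
      simp only [Finset.mem_Icc]
      refine ⟨by omega, by ring⟩
  rw [himg, Finset.card_image_of_injOn, card_Icc_neg_natCast]
  · intro s _ t _ hst
    simp only [Prod.mk.injEq] at hst
    rcases eq_or_ne c' 0 with hc0 | hc0
    · have : a' ≠ 0 := by
        rintro rfl
        simp [hc0] at hm
      exact mul_left_cancel₀ this hst.2
    · exact mul_left_cancel₀ hc0 hst.1

theorem rN_zero_eq_sum (N : ℕ) :
    rN N 0 = ∑ a ∈ Finset.Icc (-N : ℤ) N, ∑ c ∈ Finset.Icc (-N : ℤ) N,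
      (((Finset.Icc (-N : ℤ) N) ×ˢ (Finset.Icc (-N : ℤ) N)).filter
        fun x ↦ a * x.1 = c * x.2).card := by
  simp_rw [Finset.card_filter]
  rw [← Finset.sum_product', ← Finset.sum_product', ← Finset.card_filter, rN,
    ← Nat.card_eq_finsetCard]
  refine Nat.card_congr
    { toFun := fun a ↦ ⟨((a.1.1, a.1.2.2.1), (a.1.2.1, a.1.2.2.2)), ?_⟩
      invFun := fun x ↦ ⟨(x.1.1.1, x.1.2.1, x.1.1.2, x.1.2.2), ?_⟩
      left_inv := fun _ ↦ rfl
      right_inv := fun _ ↦ rfl }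
  · obtain ⟨⟨a, b, c, d⟩, ha, hb, hc, hd, h⟩ := a
    simp only [abs_le] at ha hb hc hd
    simp only [Finset.mem_filter, Finset.mem_product, Finset.mem_Icc]
    exact ⟨⟨⟨ha, hc⟩, hb, hd⟩, sub_eq_zero.1 h⟩
  · obtain ⟨⟨⟨a, c⟩, b, d⟩, h⟩ := x
    simp only [Finset.mem_filter, Finset.mem_product, Finset.mem_Icc] at h
    obtain ⟨⟨⟨ha, hc⟩, hb, hd⟩, h⟩ := h
    simp only [abs_le]
    exact ⟨ha, hb, hc, hd, sub_eq_zero.2 h⟩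

theorem abs_natCast_div_sub_div_le_one (m n : ℕ) :
    |((m / n : ℕ) : ℝ) - (m : ℝ) / n| ≤ 1 := by
  have h1 : ((m / n : ℕ) : ℝ) ≤ (m : ℝ) / n := Nat.cast_div_le
  have h2 := Nat.lt_floor_add_one ((m : ℝ) / n)
  rw [Nat.floor_div_eq_div] at h2
  rw [abs_le]
  constructor <;> linarith

/-- The ratio `gcd (a, c) / max (a, c)`, which is `0` at `a = c = 0`. -/
noncomputable def gcdDivMax (a c : ℕ) : ℝ := (a.gcd c : ℝ) / (max a c : ℕ)

theorem gcdDivMax_comm (a c : ℕ) : gcdDivMax a c = gcdDivMax c a := by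
  rw [gcdDivMax, gcdDivMax, Nat.gcd_comm, max_comm]

theorem gcdDivMax_self {n : ℕ} (hn : 0 < n) : gcdDivMax n n = 1 := by
  have : (n : ℝ) ≠ 0 := by exact_mod_cast hn.ne'
  simp [gcdDivMax, this]

theorem gcdDivMax_zero_zero : gcdDivMax 0 0 = 0 := by simp [gcdDivMax]

theorem gcdDivMax_zero_right {n : ℕ} (hn : 0 < n) : gcdDivMax n 0 = 1 := by
  have : (n : ℝ) ≠ 0 := by exact_mod_cast hn.ne'
  simp [gcdDivMax, this]

theorem sum_gcdDivMax_zero_right (N : ℕ) :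
    ∑ a ∈ Finset.range (N + 1), gcdDivMax a 0 = N := by
  rw [Finset.sum_range_succ', gcdDivMax_zero_zero]
  simp [gcdDivMax_zero_right]

theorem sum_gcdDivMax_eq_sum_divisors {n : ℕ} (hn : 0 < n) :
    ∑ k ∈ Finset.range n, gcdDivMax n k = ∑ d ∈ n.divisors, (d.totient : ℝ) / d := by
  have hn' : (n : ℝ) ≠ 0 := by exact_mod_cast hn.ne'
  have h1 : ∀ k ∈ Finset.range n, gcdDivMax n k = (n.gcd k : ℝ) / n := fun k hk ↦ by
    rw [gcdDivMax, max_eq_left (Finset.mem_range.1 hk).le]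
  rw [Finset.sum_congr rfl h1, ← Finset.sum_fiberwise_of_maps_to (t := n.divisors)
    (g := fun k ↦ n.gcd k) (fun k _ ↦ Nat.mem_divisors.2 ⟨Nat.gcd_dvd_left n k, hn.ne'⟩),
    ← Nat.sum_div_divisors n fun d ↦ (d.totient : ℝ) / d]
  refine Finset.sum_congr rfl fun d hd ↦ ?_
  have hdn := Nat.dvd_of_mem_divisors hd
  have hd0 : (d : ℝ) ≠ 0 := by exact_mod_cast (Nat.pos_of_mem_divisors hd).ne'
  rw [Nat.totient_div_of_dvd hdn, Nat.cast_div hdn hd0, Finset.sum_congr rfl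
    (g := fun _ ↦ (d : ℝ) / n) (fun k hk ↦ by rw [(Finset.mem_filter.1 hk).2]),
    Finset.sum_const, nsmul_eq_mul]
  field_simp

theorem sum_range_gcdDivMax (N : ℕ) :
    ∑ a ∈ Finset.range (N + 1), ∑ c ∈ Finset.range (N + 1), gcdDivMax a c =
      2 * ∑ n ∈ Finset.Ioc 0 N, ∑ d ∈ n.divisors, (d.totient : ℝ) / d + N := by
  induction N with
  | zero => simp [gcdDivMax_zero_zero]
  | succ N ih =>
    rw [Finset.sum_range_succ]
    simp_rw [Finset.sum_range_succ _ (N + 1)]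
    rw [Finset.sum_add_distrib, ih, gcdDivMax_self N.succ_pos,
      sum_gcdDivMax_eq_sum_divisors N.succ_pos,
      Finset.sum_congr rfl (fun a _ ↦ gcdDivMax_comm a (N + 1)),
      sum_gcdDivMax_eq_sum_divisors N.succ_pos, Finset.sum_Ioc_succ_top N.zero_le]
    push_cast
    ring

theorem sum_Icc_gcdDivMax (N : ℕ) :
    ∑ a ∈ Finset.Icc (-N : ℤ) N, ∑ c ∈ Finset.Icc (-N : ℤ) N, gcdDivMax a.natAbs c.natAbs =
      8 * ∑ n ∈ Finset.Ioc 0 N, ∑ d ∈ n.divisors, (d.totient : ℝ) / d := by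
  have inner : ∀ a : ℕ, ∑ c ∈ Finset.Icc (-N : ℤ) N, gcdDivMax a c.natAbs =
      2 * ∑ c ∈ Finset.range (N + 1), gcdDivMax a c - gcdDivMax a 0 := fun a ↦ by
    rw [Finset.sum_Icc_of_even_eq_range (fun c ↦ by rw [Int.natAbs_neg])]
    simp
  simp_rw [inner]
  rw [Finset.sum_Icc_of_even_eq_range (fun a ↦ by simp only [Int.natAbs_neg])]
  simp only [Int.natAbs_natCast, Int.natAbs_zero, Finset.sum_sub_distrib, ← Finset.mul_sum,
    sum_range_gcdDivMax, sum_gcdDivMax_zero_right, gcdDivMax_zero_zero, nsmul_eq_mul]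
  rw [Finset.sum_congr rfl (fun c _ ↦ gcdDivMax_comm 0 c), sum_gcdDivMax_zero_right]
  push_cast
  ring

theorem abs_card_filter_mul_eq_mul_sub_le (a c : ℤ) (N : ℕ) :
    |((((Finset.Icc (-N : ℤ) N) ×ˢ (Finset.Icc (-N : ℤ) N)).filter
      fun x ↦ a * x.1 = c * x.2).card : ℝ) - 2 * N * gcdDivMax a.natAbs c.natAbs| ≤
      1 + if a = 0 then if c = 0 then (2 * N + 1 : ℝ) ^ 2 else 0 else 0 := by
  by_cases h : a = 0 ∧ c = 0
  · obtain ⟨rfl, rfl⟩ := h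
    simp only [zero_mul, Finset.filter_true, Finset.card_product, card_Icc_neg_natCast,
      Int.natAbs_zero, gcdDivMax_zero_zero, mul_zero, sub_zero, if_true, Nat.cast_mul]
    rw [abs_of_nonneg (by positivity)]
    push_cast
    linarith
  · have hr : (if a = 0 then if c = 0 then (2 * N + 1 : ℝ) ^ 2 else 0 else 0) = 0 := by
      split_ifs <;> tauto
    rw [hr, card_filter_mul_eq_mul h, gcdDivMax]
    set m := max a.natAbs c.natAbs
    have h1 : ((N * a.gcd c / m : ℕ) : ℝ) ≤ ((N * a.gcd c : ℕ) : ℝ) / m := Nat.cast_div_le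
    have h2 := Nat.lt_floor_add_one (((N * a.gcd c : ℕ) : ℝ) / m)
    rw [Nat.floor_div_eq_div] at h2
    have h3 : 2 * (N : ℝ) * ((a.natAbs.gcd c.natAbs : ℝ) / m) =
        2 * (((N * a.gcd c : ℕ) : ℝ) / m) := by
      rw [Int.gcd_eq_natAbs]
      push_cast
      ring
    rw [h3, abs_le]
    push_cast at h1 h2 ⊢
    constructor <;> linarith

theorem abs_rN_zero_sub_le (N : ℕ) :
    |(rN N 0 : ℝ) - 16 * N * ∑ n ∈ Finset.Ioc 0 N, ∑ d ∈ n.divisors, (d.totient : ℝ) / d| ≤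
      2 * (2 * N + 1) ^ 2 := by
  have h : (16 * N * ∑ n ∈ Finset.Ioc 0 N, ∑ d ∈ n.divisors, (d.totient : ℝ) / d) =
      ∑ a ∈ Finset.Icc (-N : ℤ) N, ∑ c ∈ Finset.Icc (-N : ℤ) N,
        2 * N * gcdDivMax a.natAbs c.natAbs := by
    simp_rw [← Finset.mul_sum]
    rw [sum_Icc_gcdDivMax]
    ring
  rw [h, rN_zero_eq_sum]
  push_cast
  simp_rw [← Finset.sum_sub_distrib]
  calc _ ≤ ∑ a ∈ Finset.Icc (-N : ℤ) N, ∑ c ∈ Finset.Icc (-N : ℤ) N,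
        (1 + if a = 0 then if c = 0 then (2 * N + 1 : ℝ) ^ 2 else 0 else 0) := by
        refine (Finset.abs_sum_le_sum_abs _ _).trans (Finset.sum_le_sum fun a _ ↦ ?_)
        exact (Finset.abs_sum_le_sum_abs _ _).trans
          (Finset.sum_le_sum fun c _ ↦ abs_card_filter_mul_eq_mul_sub_le a c N)
    _ = 2 * (2 * N + 1) ^ 2 := by
        rw [← Finset.sum_product', Finset.sum_add_distrib, Finset.sum_product, Finset.sum_product]
        have h0 : ∀ a : ℤ, (∑ c ∈ Finset.Icc (-N : ℤ) N,
            if a = 0 then if c = 0 then (2 * N + 1 : ℝ) ^ 2 else 0 else 0) =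
            if a = 0 then (2 * N + 1 : ℝ) ^ 2 else 0 := fun a ↦ by
          split_ifs <;> simp
        simp only [h0, Finset.sum_const, card_Icc_neg_natCast, nsmul_eq_mul,
          Finset.sum_ite_eq', Finset.mem_Icc]
        simp
        ring

open ArithmeticFunction in
theorem sum_Ioc_sum_divisors_totient_div (N : ℕ) :
    ∑ n ∈ Finset.Ioc 0 N, ∑ d ∈ n.divisors, (d.totient : ℝ) / d =
      ∑ d ∈ Finset.Ioc 0 N, (d.totient : ℝ) / d * ((N / d : ℕ) : ℝ) := by
  let f : ArithmeticFunction ℝ := ⟨fun n ↦ (n.totient : ℝ) / n, by simp⟩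
  have key := sum_Ioc_mul_zeta_eq_sum f N
  simp only [coe_mul_zeta_apply] at key
  exact key

theorem abs_sum_divisors_totient_div_sub_le (N : ℕ) :
    |∑ n ∈ Finset.Ioc 0 N, ∑ d ∈ n.divisors, (d.totient : ℝ) / d -
      N * ∑ n ∈ Finset.Ioc 0 N, (n.totient : ℝ) / (n : ℝ) ^ 2| ≤ N := by
  rw [sum_Ioc_sum_divisors_totient_div, Finset.mul_sum, ← Finset.sum_sub_distrib]
  calc _ ≤ ∑ d ∈ Finset.Ioc 0 N, (1 : ℝ) := by
        refine (Finset.abs_sum_le_sum_abs _ _).trans (Finset.sum_le_sum fun d _ ↦ ?_)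
        have h : (d.totient : ℝ) / d * ((N / d : ℕ) : ℝ) - N * ((d.totient : ℝ) / (d : ℝ) ^ 2) =
            (d.totient : ℝ) / d * (((N / d : ℕ) : ℝ) - (N : ℝ) / d) := by ring
        rw [h, abs_mul, abs_of_nonneg (by positivity)]
        refine mul_le_one₀ (div_le_one_of_le₀ ?_ (by positivity)) (abs_nonneg _)
          (abs_natCast_div_sub_div_le_one N d)
        exact_mod_cast d.totient_le
    _ = N := by simp

theorem restricted_divisor_zero_asymptotic :
    ∃ C : ℝ, 0 < C ∧ ∀ N : ℕ, 1 < N →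
      |(rN N 0 : ℝ) - (16 / zetaNat 2) * (N : ℝ) ^ 2 * Real.log N| ≤
        C * (N : ℝ) ^ 2 := by
  obtain ⟨C, hC⟩ := exists_abs_sum_totient_div_sq_sub_le
  have hC0 : 0 ≤ C := (abs_nonneg _).trans (hC 1 one_pos)
  refine ⟨34 + 16 * C, by positivity, fun N hN ↦ ?_⟩
  have hN1 : (1 : ℝ) ≤ N := by exact_mod_cast hN.le
  have h1 := abs_rN_zero_sub_le N
  have h2 := abs_sum_divisors_totient_div_sub_le N
  have h3 := hC N (by omega)
  set W := ∑ n ∈ Finset.Ioc 0 N, ∑ d ∈ n.divisors, (d.totient : ℝ) / d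
  set S := ∑ n ∈ Finset.Ioc 0 N, (n.totient : ℝ) / (n : ℝ) ^ 2
  have hsplit : (rN N 0 : ℝ) - (16 / zetaNat 2) * (N : ℝ) ^ 2 * Real.log N =
      (rN N 0 - 16 * N * W) + 16 * N * (W - N * S) +
        16 * (N : ℝ) ^ 2 * (S - 1 / zetaNat 2 * Real.log N) := by ring
  rw [hsplit]
  calc _ ≤ |(rN N 0 : ℝ) - 16 * N * W| + |16 * N * (W - N * S)| +
        |16 * (N : ℝ) ^ 2 * (S - 1 / zetaNat 2 * Real.log N)| := abs_add_three _ _ _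
    _ ≤ 2 * (2 * N + 1) ^ 2 + 16 * N * N + 16 * (N : ℝ) ^ 2 * C := by
        rw [abs_mul (16 * (N : ℝ)), abs_mul (16 * (N : ℝ) ^ 2),
          abs_of_nonneg (by positivity : 0 ≤ 16 * (N : ℝ)),
          abs_of_nonneg (by positivity : 0 ≤ 16 * (N : ℝ) ^ 2)]
        gcongr
    _ ≤ (34 + 16 * C) * (N : ℝ) ^ 2 := by nlinarith
end
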